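/- Saturation for flagged skew Kostka coefficients: for a skew shape lambda/mu, flags a, b, a weight nu, and any positive integer k, K_{k*lambda/k*mu, k*nu}(a,b) > 0 implies K_{lambda/mu, nu}(a,b) > 0. -/

import Mathlib

/-!
STATEMENT 14: Saturation for flagged skew Kostka coefficients.
`flaggedKostka lam mu a b nu` is the number of semistandard Young tableaux of
skew shape `lam/mu` (rows indexed by `Fin l`, cells `(i,j)` with
`mu i < j ≤ lam i`), with positive integer entries, whose entries in row `i`
lie in the interval `{a i, …, b i}`, and with exactly `nu v` entries equal to
`v` for every `v ≥ 1`.  The theorem: for any positive integer `k`,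
`flaggedKostka (k•lam) (k•mu) a b (k•nu) > 0` implies
`flaggedKostka lam mu a b nu > 0`.
-/

/-- `(i, j)` is a cell of the skew diagram `lam/mu` (columns numbered from 1). -/
def SkewCell {l : ℕ} (lam mu : Fin l → ℕ) (c : Fin l × ℕ) : Prop :=
  mu c.1 < c.2 ∧ c.2 ≤ lam c.1

/-- `T` is a row-flagged semistandard Young tableau of shape `lam/mu` with
flags `a`, `b` (encoded as a function on all of `Fin l × ℕ`, vanishing off the
diagram). -/
def IsFlaggedSSYT {l : ℕ} (lam mu a b : Fin l → ℕ) (T : Fin l × ℕ → ℕ) : Prop :=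
  (∀ c, ¬ SkewCell lam mu c → T c = 0) ∧
  (∀ c, SkewCell lam mu c → 0 < T c) ∧
  -- rows weakly increase
  (∀ (i : Fin l) (j : ℕ), SkewCell lam mu (i, j) → SkewCell lam mu (i, j + 1) →
    T (i, j) ≤ T (i, j + 1)) ∧
  -- columns strictly increase
  (∀ (i i' : Fin l) (j : ℕ), (i' : ℕ) = (i : ℕ) + 1 →
    SkewCell lam mu (i, j) → SkewCell lam mu (i', j) → T (i, j) < T (i', j)) ∧
  -- flag conditions
  (∀ c, SkewCell lam mu c → a c.1 ≤ T c ∧ T c ≤ b c.1)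

/-- The flagged skew Kostka coefficient: the number of flagged semistandard
Young tableaux of shape `lam/mu`, flags `a,b`, and content `nu`. -/
noncomputable def flaggedKostka {l : ℕ} (lam mu a b : Fin l → ℕ) (nu : ℕ → ℕ) : ℕ :=
  Nat.card {T : Fin l × ℕ → ℕ // IsFlaggedSSYT lam mu a b T ∧
    ∀ v : ℕ, 0 < v →
      Nat.card {c : Fin l × ℕ // SkewCell lam mu c ∧ T c = v} = nu v}

open Finset in
/-- Hall's theorem for a bipartite multigraph with edge multiplicities `w` in which all left degrees
are `k` and the right degrees are `k * cap r`. -/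
theorem exists_map_of_regular_weights {L R : Type*} [Fintype L] [Fintype R] [DecidableEq R]
    (w : L → R → ℕ) (cap : R → ℕ) (k : ℕ) (hk : 0 < k)
    (hrow : ∀ x, ∑ r, w x r = k) (hcol : ∀ r, ∑ x, w x r = k * cap r) :
    ∃ F : L → R, (∀ x, 0 < w x (F x)) ∧ ∀ r, #{x | F x = r} = cap r := by
  classical
  have hall : ∀ A : Finset L, #A ≤ #(A.biUnion fun x =>
      (univ.filter fun p : (Σ r, Fin (cap r)) => 0 < w x p.1)) := by
    intro A
    set N : Finset R := univ.filter fun r => ∃ x ∈ A, 0 < w x r with hN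
    have hunion : (A.biUnion fun x => (univ.filter fun p : (Σ r, Fin (cap r)) => 0 < w x p.1))
        = N.sigma fun _ => univ := by
      ext p; simp [hN]
    rw [hunion, card_sigma]
    simp only [card_univ, Fintype.card_fin]
    refine Nat.le_of_mul_le_mul_left ?_ hk
    calc k * #A = ∑ x ∈ A, ∑ r, w x r := by simp [hrow, mul_comm]
      _ = ∑ x ∈ A, ∑ r ∈ N, w x r := by
        refine sum_congr rfl fun x hx => (sum_subset (subset_univ _) fun r _ hr => ?_).symm
        by_contra hne
        exact hr (by simpa [hN] using ⟨x, hx, Nat.pos_of_ne_zero hne⟩)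
      _ = ∑ r ∈ N, ∑ x ∈ A, w x r := sum_comm
      _ ≤ ∑ r ∈ N, ∑ x, w x r :=
        sum_le_sum fun r _ => sum_le_sum_of_subset (subset_univ _)
      _ = k * ∑ r ∈ N, cap r := by simp [hcol, mul_sum]
  obtain ⟨G, hG, hGw⟩ := (all_card_le_biUnion_card_iff_exists_injective _).1 hall
  refine ⟨fun x => (G x).1, fun x => by simpa using hGw x, ?_⟩
  have hle : ∀ r ∈ (univ : Finset R), #{x | (G x).1 = r} ≤ cap r := by
    intro r _
    have h : #(({x | (G x).1 = r} : Finset L).image G) ≤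
        #(({r} : Finset R).sigma fun r => (univ : Finset (Fin (cap r)))) := by
      refine card_le_card fun p hp => ?_
      simp only [mem_image, mem_filter, mem_univ, true_and] at hp
      obtain ⟨x, hx, rfl⟩ := hp
      simp [hx]
    rw [card_image_of_injective _ hG] at h
    simpa using h
  have hsum : ∑ r, #{x | (G x).1 = r} = ∑ r, cap r := by
    rw [← card_eq_sum_card_fiberwise (fun x _ => mem_coe.2 (mem_univ ((G x).1)))]
    refine Nat.eq_of_mul_eq_mul_left hk ?_
    calc k * #(univ : Finset L) = ∑ x, ∑ r, w x r := by simp [hrow, mul_comm]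
      _ = ∑ r, ∑ x, w x r := sum_comm
      _ = k * ∑ r, cap r := by simp [hcol, mul_sum]
  exact fun r => (sum_eq_sum_iff_of_le hle).1 hsum r (mem_univ r)

open Finset in
/-- A `k`-fold filling whose layers all have distinct values in each column, and whose content is
`k * nu`, contains a filling with distinct values in each column and content `nu`. -/
theorem exists_selection_of_layers {C J V : Type*} [Fintype C] [Fintype J] [Fintype V]
    [DecidableEq J] [DecidableEq V] (k : ℕ) (hk : 0 < k) (col : C → J) (T : C → Fin k → V)
    (nu : V → ℕ) (hdist : ∀ c c' t, col c = col c' → T c t = T c' t → c = c')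
    (hcontent : ∀ v, #{p : C × Fin k | T p.1 p.2 = v} = k * nu v) :
    ∃ f : C → V, (∀ c, ∃ t, T c t = f c) ∧ (∀ c c', col c = col c' → f c = f c' → c = c') ∧
      ∀ v, #{c | f c = v} = nu v := by
  classical
  let m : C → V → ℕ := fun c v => #{t | T c t = v}
  let d : J → V → ℕ := fun j v => ∑ c, if col c = j then m c v else 0
  have hm : ∀ c, ∑ v, m c v = k := by
    intro c
    have := card_eq_sum_card_fiberwise (s := (univ : Finset (Fin k))) (t := univ) (f := T c)
      (fun x _ => mem_coe.2 (mem_univ _))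
    simpa using this.symm
  have hd : ∀ j v, d j v ≤ k := by
    intro j v
    have h1 : d j v = ∑ t : Fin k, #{c | col c = j ∧ T c t = v} := by
      simp only [d, m, card_filter]
      rw [sum_comm]
      refine sum_congr rfl fun c _ => ?_
      by_cases h : col c = j <;> simp [h]
    rw [h1]
    calc _ ≤ ∑ _t : Fin k, 1 := by
          refine sum_le_sum fun t _ => card_le_one.2 ?_
          simp only [mem_filter, mem_univ, true_and]
          rintro c ⟨hc, hv⟩ c' ⟨hc', hv'⟩
          exact hdist c c' t (hc.trans hc'.symm) (hv.trans hv'.symm)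
      _ = k := by simp
  have hds : ∀ v, ∑ j, d j v = k * nu v := by
    intro v
    rw [← hcontent v]
    simp only [d]
    rw [sum_comm]
    simp only [m, card_filter, Fintype.sum_prod_type, sum_ite_eq, mem_univ, if_true]
  let w : C ⊕ (J × V) → (J × V) ⊕ V → ℕ := fun x r => match x, r with
    | .inl c, .inl p => if col c = p.1 then m c p.2 else 0
    | .inl _, .inr _ => 0
    | .inr q, .inl p => if q = p then k - d p.1 p.2 else 0
    | .inr q, .inr v => if q.2 = v then d q.1 q.2 else 0
  let cap : (J × V) ⊕ V → ℕ := Sum.elim (fun _ => 1) nu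
  obtain ⟨F, hFw, hF⟩ := exists_map_of_regular_weights w cap k hk
    (by
      rintro (c | q)
      · simp [w, Fintype.sum_prod_type, hm]
      · have := hd q.1 q.2
        simp [w]; omega)
    (by
      rintro (p | v)
      · have := hd p.1 p.2
        have h2 : ∑ c, (if col c = p.1 then m c p.2 else 0) = d p.1 p.2 := rfl
        simp [w, cap, h2]; omega
      · simp [w, cap, Fintype.sum_prod_type, hds])
  have hFc : ∀ c, ∃ v, F (.inl c) = .inl (col c, v) ∧ ∃ t, T c t = v := by
    intro c
    have h := hFw (.inl c)
    rcases hc : F (.inl c) with p | v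
    · rw [hc] at h
      simp only [w] at h
      split_ifs at h with hp
      · obtain ⟨t, ht⟩ := card_pos.1 h
        exact ⟨p.2, by rw [hp], t, by simpa using ht⟩
      · simp at h
    · simp [hc, w] at h
  choose f hf hfT using hFc
  have hFq : ∀ q : J × V, F (.inr q) = .inl q ∨ F (.inr q) = .inr q.2 := by
    intro q
    have h := hFw (.inr q)
    rcases hc : F (.inr q) with p | v <;> rw [hc] at h <;> simp only [w] at h <;>
      split_ifs at h with hp
    · exact .inl (by rw [hp])
    · simp at h
    · exact .inr (by rw [hp])
    · simp at h
  refine ⟨f, hfT, ?_, ?_⟩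
  · intro c c' hc hv
    have h1 : #{x | F x = .inl (col c, f c)} = 1 := hF _
    have := card_le_one.1 h1.le (.inl c) (by simp [hf]) (.inl c') (by simp [hf, hc, hv])
    simpa using this
  · intro v
    have hone : ∀ j, #{c | F (.inl c) = .inl (j, v)} = if F (.inr (j, v)) = .inr v then 1 else 0 := by
      intro j
      have h1 : #{x | F x = .inl (j, v)} = 1 := hF _
      rw [card_filter, Fintype.sum_sum_type] at h1
      have h2 : ∑ q : J × V, (if F (.inr q) = .inl (j, v) then 1 else 0)
          = if F (.inr (j, v)) = .inl (j, v) then 1 else 0 := by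
        refine sum_eq_single _ (fun q _ hq => ?_) (by simp)
        rcases hFq q with h | h <;> simp [h, hq]
      rw [h2] at h1
      rw [card_filter]
      rcases hFq (j, v) with h | h <;> simp [h] at h1 ⊢ <;> omega
    have hv : #{x | F x = .inr v} = nu v := hF _
    rw [card_filter, Fintype.sum_sum_type] at hv
    simp only [hf, reduceCtorEq, if_false, sum_const_zero, zero_add, Fintype.sum_prod_type] at hv
    rw [← hv, card_eq_sum_card_fiberwise (t := univ) (f := col) (fun x _ => mem_coe.2 (mem_univ _))]
    refine sum_congr rfl fun j _ => ?_
    rw [sum_eq_single v, ← hone j, filter_filter]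
    · congr 1
      ext c
      simp [hf, and_comm]
    · intro v' _ hne
      rcases hFq (j, v') with h | h <;> simp [h, hne]
    · simp

open Finset in
theorem Finset.card_filter_rank_le {α : Type*} [LinearOrder α] (s : Finset α) (n : ℕ)
    (hn : n ≤ #s) : #{x ∈ s | #{y ∈ s | y ≤ x} ≤ n} = n := by
  induction s using Finset.induction_on_max generalizing n with
  | empty => simp at hn; simp [hn]
  | insert a s hlt ih =>
    have ha : a ∉ s := fun h => lt_irrefl _ (hlt a h)
    have hx : ∀ x ∈ s, ({y ∈ insert a s | y ≤ x} : Finset α) = {y ∈ s | y ≤ x} := by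
      intro x hx
      rw [filter_insert, if_neg (not_le.2 (hlt x hx))]
    have htop : ({y ∈ insert a s | y ≤ a} : Finset α) = insert a s := by
      refine filter_true_of_mem fun y hy => ?_
      rcases mem_insert.1 hy with rfl | hy
      · exact le_rfl
      · exact (hlt y hy).le
    have hcongr : ({x ∈ s | #{y ∈ insert a s | y ≤ x} ≤ n} : Finset α) =
        {x ∈ s | #{y ∈ s | y ≤ x} ≤ n} := filter_congr fun x h => by rw [hx x h]
    rw [card_insert_of_notMem ha] at hn
    rw [filter_insert, htop, hcongr, card_insert_of_notMem ha]
    split_ifs with h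
    · have hs : ({x ∈ s | #{y ∈ s | y ≤ x} ≤ n} : Finset α) = s :=
        filter_true_of_mem fun x _ => (card_filter_le _ _).trans (by omega)
      rw [hs, card_insert_of_notMem ha]
      omega
    · exact ih n (by omega)

section Cells

variable {l : ℕ} (lam mu : Fin l → ℕ)

open Classical in
/-- The cells of the skew diagram `lam/mu`, as a finite set. -/
noncomputable def skewCells : Finset (Fin l × ℕ) :=
  {c ∈ Finset.univ ×ˢ Finset.range (∑ i, lam i + 1) | SkewCell lam mu c}

theorem mem_skewCells {c : Fin l × ℕ} : c ∈ skewCells lam mu ↔ SkewCell lam mu c := by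
  have h : lam c.1 ≤ ∑ i, lam i :=
    Finset.single_le_sum (fun i _ => Nat.zero_le (lam i)) (Finset.mem_univ _)
  simp only [skewCells, Finset.mem_filter, Finset.mem_product, Finset.mem_univ, true_and,
    Finset.mem_range, and_iff_right_iff_imp]
  intro hc
  have := hc.2
  omega

instance : Finite {c : Fin l × ℕ // SkewCell lam mu c} :=
  ((skewCells lam mu).finite_toSet.subset fun _ hc => (mem_skewCells lam mu).2 hc)

theorem card_cells_eq (T : Fin l × ℕ → ℕ) (v : ℕ) :
    Nat.card {c : Fin l × ℕ // SkewCell lam mu c ∧ T c = v} =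
      Finset.card {c ∈ skewCells lam mu | T c = v} :=
  Nat.subtype_card _ fun c => by simp [mem_skewCells]

end Cells

section Sorting

open Finset

variable {l : ℕ} (lam mu : Fin l → ℕ) (f : Fin l × ℕ → ℕ)

open Classical in
/-- The rows of `lam/mu` meeting column `j`. -/
noncomputable def columnRows (j : ℕ) : Finset (Fin l) := {i | SkewCell lam mu (i, j)}

/-- The position of row `i` within column `j`, counted from the top. -/
noncomputable def columnRank (i : Fin l) (j : ℕ) : ℕ := #{i' ∈ columnRows lam mu j | i' ≤ i}

/-- The number of entries of `f` in column `j` that are at most `v`. -/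
noncomputable def columnCount (j v : ℕ) : ℕ := #{i ∈ columnRows lam mu j | f (i, j) ≤ v}

/-- The number of entries at most `v` in row `i` once every column of `f` has been sorted. -/
noncomputable def rowCount (i : Fin l) (v : ℕ) : ℕ :=
  #{j ∈ Ioc (mu i) (lam i) | columnRank lam mu i j ≤ columnCount lam mu f j v}

open Classical in
/-- The filling obtained from `f` by sorting every column and then every row. -/
noncomputable def sortedFilling (c : Fin l × ℕ) : ℕ :=
  if SkewCell lam mu c then sInf {v | c.2 ≤ mu c.1 + rowCount lam mu f c.1 v} else 0

variable {lam mu f}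

theorem mem_columnRows {i : Fin l} {j : ℕ} :
    i ∈ columnRows lam mu j ↔ SkewCell lam mu (i, j) := by
  simp [columnRows]

theorem columnCount_mono (j : ℕ) : Monotone (columnCount lam mu f j) := fun _ _ h =>
  card_le_card <| monotone_filter_right _ fun _ _ hi => le_trans hi h

theorem rowCount_mono (i : Fin l) : Monotone (rowCount lam mu f i) := fun _ _ h =>
  card_le_card <| monotone_filter_right _ fun _ _ hj => le_trans hj (columnCount_mono _ h)

theorem rowCount_le (i : Fin l) (v : ℕ) : rowCount lam mu f i v ≤ lam i - mu i :=
  (card_filter_le _ _).trans (Nat.card_Ioc _ _).le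

variable {a b : Fin l → ℕ}

theorem rowCount_eq_zero_of_lt (ha : Monotone a)
    (hfa : ∀ c, SkewCell lam mu c → a c.1 ≤ f c) {i : Fin l} {v : ℕ} (hv : v < a i) :
    rowCount lam mu f i v = 0 := by
  refine card_eq_zero.2 (filter_eq_empty_iff.2 fun j hj => not_le.2 ?_)
  have hc : SkewCell lam mu (i, j) := mem_Ioc.1 hj
  refine card_lt_card (ssubset_iff_of_subset ?_ |>.2 ⟨i, ?_, ?_⟩)
  · intro i' hi'
    simp only [mem_filter, mem_columnRows] at hi' ⊢
    refine ⟨hi'.1, ?_⟩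
    by_contra! hlt
    have := hfa _ hi'.1
    have := ha hlt.le
    simp only at *
    omega
  · simp [mem_columnRows, hc]
  · have := hfa _ hc
    simp only at this
    simp only [mem_filter, not_and, not_le]
    omega

theorem rowCount_eq_of_le (hb : Monotone b)
    (hfb : ∀ c, SkewCell lam mu c → f c ≤ b c.1) {i : Fin l} {v : ℕ} (hv : b i ≤ v) :
    rowCount lam mu f i v = lam i - mu i := by
  rw [rowCount, filter_true_of_mem, Nat.card_Ioc]
  intro j _
  refine card_le_card fun i' hi' => ?_
  simp only [mem_filter, mem_columnRows] at hi' ⊢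
  exact ⟨hi'.1, ((hfb _ hi'.1).trans (hb hi'.2)).trans hv⟩

theorem sortedFilling_le_iff (hb : Monotone b)
    (hfb : ∀ c, SkewCell lam mu c → f c ≤ b c.1) {i : Fin l} {j v : ℕ}
    (hc : SkewCell lam mu (i, j)) :
    sortedFilling lam mu f (i, j) ≤ v ↔ j ≤ mu i + rowCount lam mu f i v := by
  have hne : {v | j ≤ mu i + rowCount lam mu f i v}.Nonempty := by
    refine ⟨b i, ?_⟩
    have h1 := hc.1
    have h2 := hc.2
    simp only [Set.mem_ofPred_eq, rowCount_eq_of_le hb hfb le_rfl] at *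
    omega
  rw [sortedFilling, if_pos hc]
  constructor
  · intro h
    have hmem : j ≤ mu i + rowCount lam mu f i (sInf {v | j ≤ mu i + rowCount lam mu f i v}) :=
      Nat.sInf_mem hne
    exact hmem.trans (Nat.add_le_add_left (rowCount_mono i h) _)
  · exact fun h => Nat.sInf_le h

theorem columnCount_succ_le
    (hinj : ∀ i i' j, SkewCell lam mu (i, j) → SkewCell lam mu (i', j) →
      f (i, j) = f (i', j) → i = i') (j v : ℕ) :
    columnCount lam mu f j (v + 1) ≤ columnCount lam mu f j v + 1 := by
  have hsub : ({i ∈ columnRows lam mu j | f (i, j) ≤ v + 1} : Finset (Fin l)) ⊆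
      {i ∈ columnRows lam mu j | f (i, j) ≤ v} ∪ {i ∈ columnRows lam mu j | f (i, j) = v + 1} := by
    intro i hi
    simp only [mem_filter, mem_union] at hi ⊢
    have := hi.2
    rcases Nat.lt_or_ge v (f (i, j)) with h | h
    · exact .inr ⟨hi.1, by omega⟩
    · exact .inl ⟨hi.1, h⟩
  have hone : #{i ∈ columnRows lam mu j | f (i, j) = v + 1} ≤ 1 := by
    refine card_le_one.2 fun i hi i' hi' => ?_
    simp only [mem_filter, mem_columnRows] at hi hi'
    exact hinj i i' j hi.1 hi'.1 (hi.2.trans hi'.2.symm)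
  exact (card_le_card hsub).trans ((card_union_le _ _).trans (Nat.add_le_add_left hone _))

theorem columnRank_succ {i i' : Fin l} {j : ℕ} (hi : (i' : ℕ) = i + 1)
    (hc : SkewCell lam mu (i', j)) :
    columnRank lam mu i' j = columnRank lam mu i j + 1 := by
  have : ({r ∈ columnRows lam mu j | r ≤ i'} : Finset (Fin l)) =
      insert i' {r ∈ columnRows lam mu j | r ≤ i} := by
    ext r
    simp only [mem_filter, mem_insert, mem_columnRows, Fin.le_def, Fin.ext_iff]
    constructor
    · rintro ⟨h, hr⟩
      rcases Nat.lt_or_ge (i : ℕ) r with h' | h'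
      · exact .inl (by omega)
      · exact .inr ⟨h, h'⟩
    · rintro (h | ⟨h, hr⟩)
      · rw [Fin.ext h]
        exact ⟨hc, le_rfl⟩
      · exact ⟨h, by omega⟩
  rw [columnRank, this, card_insert_of_notMem]
  · rfl
  · simp only [mem_filter, Fin.le_def, not_and]
    omega

theorem rowCount_succ_le (hlam : Antitone lam) (hmu : Antitone mu)
    (hinj : ∀ i i' j, SkewCell lam mu (i, j) → SkewCell lam mu (i', j) →
      f (i, j) = f (i', j) → i = i') {i i' : Fin l} (hi : (i' : ℕ) = i + 1) (v : ℕ) :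
    mu i' + rowCount lam mu f i' (v + 1) ≤ mu i + rowCount lam mu f i v := by
  have hle : i ≤ i' := Fin.le_def.2 (by omega)
  have hl := hlam hle
  have hm := hmu hle
  have hsub : ({j ∈ Ioc (mu i') (lam i') |
        columnRank lam mu i' j ≤ columnCount lam mu f j (v + 1)} : Finset ℕ) ⊆
      Ioc (mu i') (mu i) ∪
        {j ∈ Ioc (mu i) (lam i) | columnRank lam mu i j ≤ columnCount lam mu f j v} := by
    intro j hj
    simp only [mem_filter, mem_union, mem_Ioc] at hj ⊢
    have h1 := columnRank_succ (lam := lam) (mu := mu) (j := j) hi hj.1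
    have h2 := columnCount_succ_le hinj j v
    omega
  have := (card_le_card hsub).trans (card_union_le _ _)
  rw [Nat.card_Ioc] at this
  simp only [rowCount]
  omega

theorem card_skewCells_filter (p : Fin l × ℕ → Prop) [DecidablePred p] :
    #{c ∈ skewCells lam mu | p c} = ∑ i, #{j ∈ Ioc (mu i) (lam i) | p (i, j)} := by
  rw [← card_sigma]
  refine card_bij' (fun c _ => ⟨c.1, c.2⟩) (fun c _ => (c.1, c.2)) ?_ ?_ ?_ ?_ <;>
    simp [mem_skewCells, SkewCell]

theorem card_skewCells_filter' (p : Fin l × ℕ → Prop) [DecidablePred p] :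
    #{c ∈ skewCells lam mu | p c} =
      ∑ j ∈ (skewCells lam mu).image Prod.snd, #{i ∈ columnRows lam mu j | p (i, j)} := by
  rw [← card_sigma]
  refine card_bij' (fun c _ => ⟨c.2, c.1⟩) (fun c _ => (c.2, c.1)) ?_ ?_ ?_ ?_ <;>
    simp +contextual [mem_skewCells, mem_columnRows]
  intro i j h _
  exact ⟨i, h⟩

theorem card_sortedFilling_le (hb : Monotone b)
    (hfb : ∀ c, SkewCell lam mu c → f c ≤ b c.1) (v : ℕ) :
    #{c ∈ skewCells lam mu | sortedFilling lam mu f c ≤ v} =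
      #{c ∈ skewCells lam mu | f c ≤ v} := by
  calc #{c ∈ skewCells lam mu | sortedFilling lam mu f c ≤ v}
      = ∑ i, rowCount lam mu f i v := by
        rw [card_skewCells_filter]
        refine sum_congr rfl fun i _ => ?_
        have : ({j ∈ Ioc (mu i) (lam i) | sortedFilling lam mu f (i, j) ≤ v} : Finset ℕ) =
            Ioc (mu i) (mu i + rowCount lam mu f i v) := by
          ext j
          have hr := rowCount_le (lam := lam) (mu := mu) (f := f) i v
          simp only [mem_filter, mem_Ioc]
          constructor
          · exact fun h => ⟨h.1.1, (sortedFilling_le_iff hb hfb h.1).1 h.2⟩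
          · intro h
            have hc : SkewCell lam mu (i, j) := ⟨h.1, by simp only; omega⟩
            exact ⟨hc, (sortedFilling_le_iff hb hfb hc).2 h.2⟩
        rw [this, Nat.card_Ioc, Nat.add_sub_cancel_left]
    _ = #{c ∈ skewCells lam mu | columnRank lam mu c.1 c.2 ≤ columnCount lam mu f c.2 v} :=
        by simp only [rowCount, card_skewCells_filter]
    _ = #{c ∈ skewCells lam mu | f c ≤ v} := by
        rw [card_skewCells_filter', card_skewCells_filter']
        refine sum_congr rfl fun j _ => ?_
        have hle : columnCount lam mu f j v ≤ #(columnRows lam mu j) := card_filter_le _ _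
        exact card_filter_rank_le (columnRows lam mu j) _ hle

theorem card_sortedFilling_eq (hb : Monotone b)
    (hfb : ∀ c, SkewCell lam mu c → f c ≤ b c.1) (v : ℕ) :
    #{c ∈ skewCells lam mu | sortedFilling lam mu f c = v + 1} =
      #{c ∈ skewCells lam mu | f c = v + 1} := by
  have key : ∀ g : Fin l × ℕ → ℕ, #{c ∈ skewCells lam mu | g c ≤ v + 1} =
      #{c ∈ skewCells lam mu | g c ≤ v} + #{c ∈ skewCells lam mu | g c = v + 1} := by
    intro g
    rw [← card_union_of_disjoint, ← filter_or]
    · exact congrArg card (filter_congr fun c _ => by omega)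
    · exact disjoint_filter.2 fun c _ h => by omega
  have h1 := key (sortedFilling lam mu f)
  have h2 := key f
  rw [card_sortedFilling_le hb hfb, card_sortedFilling_le hb hfb] at h1
  omega

theorem isFlaggedSSYT_sortedFilling (hlam : Antitone lam) (hmu : Antitone mu)
    (ha : Monotone a) (hb : Monotone b) (hpos : ∀ c, SkewCell lam mu c → 0 < f c)
    (hfa : ∀ c, SkewCell lam mu c → a c.1 ≤ f c) (hfb : ∀ c, SkewCell lam mu c → f c ≤ b c.1)
    (hinj : ∀ i i' j, SkewCell lam mu (i, j) → SkewCell lam mu (i', j) →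
      f (i, j) = f (i', j) → i = i') :
    IsFlaggedSSYT lam mu a b (sortedFilling lam mu f) := by
  have hge : ∀ d : Fin l → ℕ, Monotone d → (∀ c, SkewCell lam mu c → d c.1 ≤ f c) →
      ∀ c, SkewCell lam mu c → d c.1 ≤ sortedFilling lam mu f c := by
    rintro d hd hfd ⟨i, j⟩ hc
    by_contra! hlt
    have h := (sortedFilling_le_iff hb hfb hc).1 le_rfl
    rw [rowCount_eq_zero_of_lt hd hfd hlt] at h
    exact absurd hc.1 (not_lt.2 h)
  have hgepos := hge (fun _ => 1) monotone_const hpos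
  refine ⟨fun c hc => if_neg hc, hgepos, ?_, ?_, fun c hc => ⟨hge a ha hfa c hc, ?_⟩⟩
  · intro i j hc hc'
    rw [sortedFilling_le_iff hb hfb hc]
    exact (Nat.le_succ j).trans ((sortedFilling_le_iff hb hfb hc').1 le_rfl)
  · intro i i' j hi hc hc'
    obtain ⟨v, hv⟩ := Nat.exists_eq_add_of_lt (hgepos _ hc')
    rw [zero_add] at hv
    rw [hv, Nat.lt_succ_iff, sortedFilling_le_iff hb hfb hc]
    exact ((sortedFilling_le_iff hb hfb hc').1 hv.le).trans (rowCount_succ_le hlam hmu hinj hi v)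
  · obtain ⟨i, j⟩ := c
    have h1 := hc.1
    have h2 := hc.2
    rw [sortedFilling_le_iff hb hfb hc, rowCount_eq_of_le hb hfb le_rfl]
    simp only at h1 h2
    omega

end Sorting

theorem IsFlaggedSSYT.column_strict {l : ℕ} {lam mu a b : Fin l → ℕ} {T : Fin l × ℕ → ℕ}
    (hT : IsFlaggedSSYT lam mu a b T) (hlam : Antitone lam) (hmu : Antitone mu)
    {i i' : Fin l} {j : ℕ} (hi : i < i') (hc : SkewCell lam mu (i, j))
    (hc' : SkewCell lam mu (i', j)) : T (i, j) < T (i', j) := by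
  obtain ⟨n, hn⟩ := Nat.exists_eq_add_of_lt (Fin.lt_def.1 hi)
  induction n generalizing i' with
  | zero => exact hT.2.2.2.1 i i' j hn hc hc'
  | succ n ih =>
    let m : Fin l := ⟨i + n + 1, by omega⟩
    have him : i < m := Fin.lt_def.2 (by simp only [m]; omega)
    have hmi : m ≤ i' := Fin.le_def.2 (by simp only [m]; omega)
    have hcm : SkewCell lam mu (m, j) :=
      ⟨(hmu him.le).trans_lt hc.1, hc'.2.trans (hlam hmi)⟩
    exact (ih him hcm rfl).trans (hT.2.2.2.1 m i' j (by simp only [m]; omega) hcm hc')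

/-- The `t`-th of the `k` cells of `(k * lam)/(k * mu)` lying over the cell `c` of `lam/mu`. -/
def layerCell {l : ℕ} (k : ℕ) (c : Fin l × ℕ) (t : Fin k) : Fin l × ℕ :=
  (c.1, k * (c.2 - 1) + t + 1)

section Layers

variable {l : ℕ} {lam mu : Fin l → ℕ} {k : ℕ}

theorem skewCell_layerCell {c : Fin l × ℕ} (hc : SkewCell lam mu c) (t : Fin k) :
    SkewCell (fun i => k * lam i) (fun i => k * mu i) (layerCell k c t) := by
  obtain ⟨i, j⟩ := c
  have h1 : mu i < j := hc.1
  have h2 : j ≤ lam i := hc.2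
  obtain ⟨j, rfl⟩ := Nat.exists_eq_add_of_lt h1
  have h3 := Nat.mul_le_mul_left k h2
  have h4 : k * mu i ≤ k * (mu i + j) := Nat.mul_le_mul_left k (Nat.le_add_right _ _)
  have ht := t.2
  simp only [layerCell, SkewCell, Nat.add_sub_cancel]
  rw [Nat.mul_add k (mu i + j) 1] at h3
  omega

open Finset in
theorem card_layers (T : Fin l × ℕ → ℕ) (v : ℕ) [Fintype {c // SkewCell lam mu c}] :
    #{p : {c // SkewCell lam mu c} × Fin k | T (layerCell k p.1 p.2) = v} =
      #{c ∈ skewCells (fun i => k * lam i) (fun i => k * mu i) | T c = v} := by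
  refine card_bij (fun p _ => layerCell k p.1 p.2) ?_ ?_ ?_
  · intro p hp
    simp only [mem_filter, mem_univ, true_and, mem_skewCells] at hp ⊢
    exact ⟨skewCell_layerCell p.1.2 p.2, hp⟩
  · rintro ⟨⟨⟨i, j⟩, hc⟩, t⟩ _ ⟨⟨⟨i', j'⟩, hc'⟩, t'⟩ _ h
    simp only [layerCell, Prod.mk.injEq, Nat.add_right_cancel_iff] at h
    have h1 : mu i < j := hc.1
    have h1' : mu i' < j' := hc'.1
    have hk : 0 < k := t.pos
    have hmod := congrArg (· % k) h.2
    have hdiv := congrArg (· / k) h.2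
    simp only [Nat.mul_add_mod, Nat.mod_eq_of_lt t.2, Nat.mod_eq_of_lt t'.2,
      Nat.mul_add_div hk, Nat.div_eq_of_lt t.2, Nat.div_eq_of_lt t'.2] at hmod hdiv
    have hj : j = j' := by omega
    simp only [Prod.mk.injEq, Subtype.mk.injEq]
    exact ⟨⟨h.1, hj⟩, Fin.ext hmod⟩
  · rintro ⟨i, n⟩ hn
    simp only [mem_filter, mem_skewCells] at hn
    have h1 : k * mu i < n := hn.1.1
    have h2 : n ≤ k * lam i := hn.1.2
    have hk : 0 < k := by
      by_contra! h0
      simp only [Nat.le_zero.1 h0] at h1 h2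
      omega
    have hcell : layerCell k (i, (n - 1) / k + 1) ⟨(n - 1) % k, Nat.mod_lt _ hk⟩ = (i, n) := by
      simp only [layerCell, Nat.add_sub_cancel, Nat.div_add_mod, Prod.mk.injEq, true_and]
      omega
    have hc : SkewCell lam mu (i, (n - 1) / k + 1) := by
      refine ⟨Nat.lt_succ_of_le ((Nat.le_div_iff_mul_le hk).2 ?_), (Nat.div_lt_iff_lt_mul hk).2 ?_⟩
      · simp only [mul_comm _ k]; omega
      · simp only [mul_comm _ k]; omega
    refine ⟨(⟨_, hc⟩, ⟨(n - 1) % k, Nat.mod_lt _ hk⟩), ?_, hcell⟩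
    simp only [mem_filter, mem_univ, true_and, hcell, hn.2]

end Layers

instance finite_flaggedSSYT {l : ℕ} (lam mu a b : Fin l → ℕ) :
    Finite {T : Fin l × ℕ → ℕ // IsFlaggedSSYT lam mu a b T} := by
  refine Finite.of_injective (β := ∀ c : {c // SkewCell lam mu c}, Fin (b c.1.1 + 1))
    (fun T c => ⟨T.1 c, Nat.lt_succ_of_le (T.2.2.2.2.2 c c.2).2⟩) fun T T' h => ?_
  ext c
  by_cases hc : SkewCell lam mu c
  · simpa using congrFun h ⟨c, hc⟩
  · rw [T.2.1 c hc, T'.2.1 c hc]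

open Finset in
/-- A flagged semistandard tableau of shape `(k * lam)/(k * mu)` and content `k * nu` yields a
flagged filling of `lam/mu` of content `nu` with distinct entries in each column. -/
theorem exists_filling_of_scaled {l : ℕ} {lam mu a b : Fin l → ℕ} {nu : ℕ → ℕ}
    (hlam : Antitone lam) (hmu : Antitone mu) {k : ℕ} (hk : 0 < k) {T : Fin l × ℕ → ℕ}
    (hT : IsFlaggedSSYT (fun i => k * lam i) (fun i => k * mu i) a b T)
    (hcontent : ∀ v, 0 < v →
      #{c ∈ skewCells (fun i => k * lam i) (fun i => k * mu i) | T c = v} = k * nu v) :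
    ∃ f : Fin l × ℕ → ℕ, (∀ c, SkewCell lam mu c → 0 < f c ∧ a c.1 ≤ f c ∧ f c ≤ b c.1) ∧
      (∀ i i' j, SkewCell lam mu (i, j) → SkewCell lam mu (i', j) →
        f (i, j) = f (i', j) → i = i') ∧
      ∀ v, 0 < v → #{c ∈ skewCells lam mu | f c = v} = nu v := by
  classical
  let C := {c : Fin l × ℕ // SkewCell lam mu c}
  let J := Set.range fun c : C => c.1.2
  let V := Set.range fun p : C × Fin k => T (layerCell k p.1 p.2)
  let _ : Fintype C := Fintype.ofFinite C
  let _ : Fintype J := Fintype.ofFinite J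
  let _ : Fintype V := Fintype.ofFinite V
  have hkl : Antitone fun i => k * lam i := fun _ _ h => Nat.mul_le_mul_left k (hlam h)
  have hkm : Antitone fun i => k * mu i := fun _ _ h => Nat.mul_le_mul_left k (hmu h)
  obtain ⟨f, hfT, hfinj, hfnu⟩ := exists_selection_of_layers k hk
    (fun c : C => (⟨c.1.2, c, rfl⟩ : J)) (fun c t => (⟨T (layerCell k c t), (c, t), rfl⟩ : V))
    (fun v => nu v)
    (by
      rintro ⟨⟨i, j⟩, hc⟩ ⟨⟨i', j'⟩, hc'⟩ t hj hv
      obtain rfl : j = j' := congrArg Subtype.val hj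
      have hv : T (layerCell k (i, j) t) = T (layerCell k (i', j) t) := congrArg Subtype.val hv
      have h1 := skewCell_layerCell hc t
      have h2 := skewCell_layerCell hc' t
      rcases lt_trichotomy i i' with h | rfl | h
      · exact absurd hv (hT.column_strict hkl hkm h h1 h2).ne
      · rfl
      · exact absurd hv (hT.column_strict hkl hkm h h2 h1).ne')
    (by
      rintro ⟨v, ⟨c, t⟩, hv⟩
      have hpos : 0 < v := hv ▸ hT.2.1 _ (skewCell_layerCell c.2 t)
      rw [← hcontent v hpos, ← card_layers (lam := lam) (mu := mu) T v]
      exact congrArg card (filter_congr fun _ _ => Subtype.mk_eq_mk))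
  let g : Fin l × ℕ → ℕ := fun c => if h : SkewCell lam mu c then f ⟨c, h⟩ else 0
  have hg : ∀ c (h : SkewCell lam mu c), g c = f ⟨c, h⟩ := fun c h => dif_pos h
  refine ⟨g, fun c hc => ?_, fun i i' j hc hc' h => ?_, fun v hv => ?_⟩
  · obtain ⟨t, ht⟩ := hfT ⟨c, hc⟩
    have hl := skewCell_layerCell hc t
    rw [hg c hc, ← ht]
    exact ⟨hT.2.1 _ hl, hT.2.2.2.2 _ hl⟩
  · rw [hg _ hc, hg _ hc'] at h
    have := hfinj ⟨_, hc⟩ ⟨_, hc'⟩ rfl (Subtype.ext h)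
    exact congrArg (fun c : C => c.1.1) this
  · have hcard : #{c ∈ skewCells lam mu | g c = v} = #{c : C | (f c : ℕ) = v} := by
      refine (card_bij (fun c _ => c.1) ?_ (fun _ _ _ _ => Subtype.ext) ?_).symm
      · intro c hc
        simpa [mem_skewCells, c.2, hg c.1 c.2] using hc
      · intro c hc
        simp only [mem_filter, mem_skewCells] at hc
        exact ⟨⟨c, hc.1⟩, by simpa [← hg c hc.1] using hc.2, rfl⟩
    rw [hcard]
    by_cases hvr : v ∈ V
    · rw [← hfnu ⟨v, hvr⟩]
      simp only [Subtype.ext_iff]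
    · have hzero : k * nu v = 0 := by
        rw [← hcontent v hv, ← card_layers T v, card_eq_zero, filter_eq_empty_iff]
        exact fun p _ h => hvr ⟨p, h⟩
      rw [(Nat.mul_eq_zero.1 hzero).resolve_left hk.ne', card_eq_zero, filter_eq_empty_iff]
      exact fun c _ h => hvr (h ▸ (f c).2)

theorem flagged_kostka_saturation {l : ℕ} (lam mu a b : Fin l → ℕ) (nu : ℕ → ℕ)
    (hlam : Antitone lam) (hmu : Antitone mu) (hsub : ∀ i, mu i ≤ lam i)
    (ha : Monotone a) (hb : Monotone b)
    (k : ℕ) (hk : 0 < k)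
    (h : 0 < flaggedKostka (fun i => k * lam i) (fun i => k * mu i) a b
        (fun v => k * nu v)) :
    0 < flaggedKostka lam mu a b nu := by
  obtain ⟨⟨T, hT, hTnu⟩⟩ := (Nat.card_pos_iff.1 h).1
  obtain ⟨f, hf, hfinj, hfnu⟩ := exists_filling_of_scaled hlam hmu hk hT fun v hv => by
    rw [← card_cells_eq, hTnu v hv]
  have hfb := fun c hc => (hf c hc).2.2
  refine Nat.card_pos_iff.2 ⟨⟨sortedFilling lam mu f, isFlaggedSSYT_sortedFilling hlam hmu ha hb
    (fun c hc => (hf c hc).1) (fun c hc => (hf c hc).2.1) hfb hfinj, fun v hv => ?_⟩, ?_⟩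
  · obtain ⟨v, rfl⟩ := Nat.exists_eq_add_one.2 hv
    rw [card_cells_eq, card_sortedFilling_eq hb hfb, hfnu _ hv]
  · exact Finite.of_injective
      (fun T => (⟨T.1, T.2.1⟩ : {T : Fin l × ℕ → ℕ // IsFlaggedSSYT lam mu a b T}))
      fun _ _ h => Subtype.ext (Subtype.mk.inj h)
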